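/- If (L,τ⁻¹) satisfies conditions (c0)–(c4), then the relation on Λ defined by λ₁ ≤ λ₂ iff φ(x)_{λ₁} ≥ φ(x)_{λ₂} for all x ∈ L is a partial order on Λ; in particular it is antisymmetric. -/

import Mathlib

/-!
Setup: an infinite distributive lattice `L` with maximum element (`⊤`) and a map
`t = τ⁻¹ : L → L` which is injective, preserves binary joins and meets, reflects
and preserves the order, and maps covering pairs to covering pairs.

A covering pair is encoded as `p : L × L` with `p.2 ⋖ p.1` (i.e. `p.1` covers `p.2`,
written `p.1 ⋗ p.2` in the paper).
-/

/-- The generating relation for the equivalence `∼` on covering pairs: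
(a) `(x ⋗ y) ∼ (τ⁻¹x ⋗ τ⁻¹y)`; (b) `(x ⋗ y) ∼ (x' ⋗ y')` whenever `x ⋗ x'` and `y ⋗ y'`. -/
def CPGen {L : Type*} [PartialOrder L] (t : L → L) (p q : L × L) : Prop :=
  (p.2 ⋖ p.1 ∧ q = (t p.1, t p.2)) ∨
  (p.2 ⋖ p.1 ∧ q.2 ⋖ q.1 ∧ q.1 ⋖ p.1 ∧ q.2 ⋖ p.2)

/-- The equivalence relation `∼` on covering pairs: the smallest equivalence relation
containing the generating relation `CPGen`. -/
def CPeq {L : Type*} [PartialOrder L] (t : L → L) : L × L → L × L → Prop :=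
  Relation.EqvGen (CPGen t)

/-- `t = τ⁻¹` is injective, preserves binary joins and meets, reflects and preserves
the order, and maps covering pairs to covering pairs. -/
structure TauMap {L : Type*} [Lattice L] (t : L → L) : Prop where
  inj : Function.Injective t
  map_sup : ∀ x y : L, t (x ⊔ y) = t x ⊔ t y
  map_inf : ∀ x y : L, t (x ⊓ y) = t x ⊓ t y
  le_iff : ∀ x y : L, x ≤ y ↔ t x ≤ t y
  cov : ∀ x y : L, x ⋖ y → t x ⋖ t y

/-- `P := L ∖ τ⁻¹(L)`. -/
def TauP {L : Type*} (t : L → L) : Set L := {x | x ∉ Set.range t}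

/-- `w 0 ⋗ w 1 ⋗ ⋯ ⋗ w r` is a covering chain. -/
def IsCovChain {L : Type*} [PartialOrder L] (w : ℕ → L) (r : ℕ) : Prop :=
  ∀ i < r, w (i + 1) ⋖ w i

/-- (c0): `P` is nonempty and finite. -/
def CondC0 {L : Type*} (t : L → L) : Prop := (TauP t).Nonempty ∧ (TauP t).Finite

/-- (c1): every element of `L` equals `τ^{-r} p` for a unique pair `(r, p) ∈ ℕ × P`. -/
def CondC1 {L : Type*} (t : L → L) : Prop :=
  ∀ x : L, ∃! rp : ℕ × L, rp.2 ∈ TauP t ∧ t^[rp.1] rp.2 = x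

/-- (c2): for all `x, y ∈ P` and `r > 0`, `x < τ^{-r} y` fails. -/
def CondC2 {L : Type*} [PartialOrder L] (t : L → L) : Prop :=
  ∀ x ∈ TauP t, ∀ y ∈ TauP t, ∀ r : ℕ, 0 < r → ¬ x < t^[r] y

/-- (c3): `x ⋗ y` implies `y ≥ τ⁻¹ x`. -/
def CondC3 {L : Type*} [PartialOrder L] (t : L → L) : Prop :=
  ∀ x y : L, y ⋖ x → t x ≤ y

/-- (c4): for every `x ∈ P` there is a covering chain from `x` to `τ⁻¹x` whose covering
pairs lie in pairwise distinct `∼`-classes forming a complete set of representatives of `Λ`. -/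
def CondC4 {L : Type*} [PartialOrder L] (t : L → L) : Prop :=
  ∀ x ∈ TauP t, ∃ (r : ℕ) (w : ℕ → L), w 0 = x ∧ w r = t x ∧ IsCovChain w r ∧
    (∀ i < r, ∀ j < r, i ≠ j → ¬ CPeq t (w i, w (i + 1)) (w j, w (j + 1))) ∧
    (∀ p : L × L, p.2 ⋖ p.1 → ∃ i < r, CPeq t (w i, w (i + 1)) p)

/-- `φ(w, λ)` for a covering chain `w` of length `r`, with the class `λ` represented by a
covering pair `p`: the number of indices whose covering pair is `∼`-equivalent to `p`. -/
noncomputable def chainCnt {L : Type*} [PartialOrder L] (t : L → L) (w : ℕ → L) (r : ℕ) (p : L × L) : ℕ :=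
  Set.ncard {i : ℕ | i < r ∧ CPeq t (w i, w (i + 1)) p}

open scoped Classical in
/-- `φ(x)_λ` (`λ` represented by the covering pair `p`), computed from a covering chain
from the maximum element `⊤` to `x`. -/
noncomputable def phi {L : Type*} [PartialOrder L] [OrderTop L] (t : L → L) (x : L)
    (p : L × L) : ℕ :=
  if h : ∃ (w : ℕ → L) (r : ℕ), w 0 = ⊤ ∧ w r = x ∧ IsCovChain w r then
    chainCnt t h.choose h.choose_spec.choose p
  else 0

open scoped Classical in
/-- `CovPath t p e x n k`: there is a covering chain of length `n` from `x` down to `e`, of which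
exactly `k` covering pairs are equivalent to `p`. -/
inductive CovPath {L : Type*} [PartialOrder L] (t : L → L) (p : L × L) (e : L) :
    L → ℕ → ℕ → Prop
  | nil : CovPath t p e e 0 0
  | cons {x y : L} {n k : ℕ} : y ⋖ x → CovPath t p e y n k →
      CovPath t p e x (n + 1) (k + if CPeq t (x, y) p then 1 else 0)

section Order

variable {L : Type*} [PartialOrder L] {t : L → L} {p : L × L}

theorem CovPath.le {e x : L} {n k : ℕ} (h : CovPath t p e x n k) : e ≤ x := by
  induction h with
  | nil => exact le_rfl
  | cons hxy _ ih => exact ih.trans hxy.le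

open scoped Classical in
theorem CovPath.snoc {e f x : L} {n k : ℕ} (h : CovPath t p e x n k) (hf : f ⋖ e) :
    CovPath t p f x (n + 1) (k + if CPeq t (e, f) p then 1 else 0) := by
  induction h with
  | nil => exact .cons hf .nil
  | cons hxy _ ih => simpa only [add_right_comm] using CovPath.cons hxy ih

open scoped Classical in
theorem chainCnt_eq_sum (w : ℕ → L) (r : ℕ) :
    chainCnt t w r p = ∑ i ∈ Finset.range r, if CPeq t (w i, w (i + 1)) p then 1 else 0 := by
  rw [chainCnt, ← Finset.card_filter, ← Set.ncard_coe_finset]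
  congr 1
  ext i
  simp

theorem IsCovChain.covPath {w : ℕ → L} {r : ℕ} {x y : L} (h0 : w 0 = x) (hr : w r = y)
    (h : IsCovChain w r) : CovPath t p y x r (chainCnt t w r p) := by
  classical
  subst h0 hr
  rw [chainCnt_eq_sum]
  induction r with
  | zero => simpa using CovPath.nil
  | succ r ih =>
    rw [Finset.sum_range_succ]
    exact (ih fun i hi => h i (by omega)).snoc (h r (by omega))

theorem IsCovChain.reflTransGen {w : ℕ → L} {r : ℕ} (h : IsCovChain w r) :
    Relation.ReflTransGen (fun a b => b ⋖ a) (w 0) (w r) := by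
  induction r with
  | zero => exact .refl
  | succ r ih => exact (ih fun i hi => h i (by omega)).tail (h r (by omega))

theorem exists_isCovChain {x y : L} (h : Relation.ReflTransGen (fun a b => b ⋖ a) x y) :
    ∃ (w : ℕ → L) (r : ℕ), w 0 = x ∧ w r = y ∧ IsCovChain w r := by
  induction h with
  | refl => exact ⟨fun _ => x, 0, rfl, rfl, fun i hi => absurd hi (by omega)⟩
  | @tail b c _ hbc ih =>
    obtain ⟨w, r, h0, hr, hw⟩ := ih
    refine ⟨fun i => if i ≤ r then w i else c, r + 1, by simp [h0], by simp, fun i hi => ?_⟩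
    rcases Nat.lt_succ_iff_lt_or_eq.mp hi with hi | rfl
    · simpa [hi.le, Nat.succ_le_of_lt hi] using hw i hi
    · simpa [hr] using hbc

theorem covPath_phi [OrderTop L] {x : L}
    (h : Relation.ReflTransGen (fun a b => b ⋖ a) (⊤ : L) x) :
    ∃ n, CovPath t p x ⊤ n (phi t x p) := by
  have hex := exists_isCovChain h
  obtain ⟨h0, hr, hw⟩ := hex.choose_spec.choose_spec
  rw [phi, dif_pos hex]
  exact ⟨_, hw.covPath h0 hr⟩

end Order

theorem CovBy.inf_covBy_of_ne {L : Type*} [DistribLattice L] {x y z : L} (hy : y ⋖ x)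
    (hz : z ⋖ x) (hne : y ≠ z) : y ⊓ z ⋖ y ∧ y ⊓ z ⋖ z := by
  have hsup : y ⊔ z = x := hy.wcovBy.sup_eq hz.wcovBy hne
  exact ⟨inf_covBy_of_covBy_sup_right (hsup ▸ hz), inf_covBy_of_covBy_sup_left (hsup ▸ hy)⟩

section Distrib

variable {L : Type*} [DistribLattice L] {t : L → L} {p : L × L}

theorem CovPath.exists_of_covBy {e : L} {n : ℕ} : ∀ {x z : L} {k : ℕ},
    CovPath t p e x n k → z ⋖ x → e ≤ z → ∃ m l, m + 1 = n ∧ CovPath t p e z m l := by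
  induction n with
  | zero =>
    rintro x z k h hz he
    cases h
    exact absurd hz.lt he.not_gt
  | succ n ih =>
    rintro x z k h hz he
    cases h with
    | @cons _ y _ k hy h =>
      by_cases hne : y = z
      · exact ⟨n, k, rfl, hne ▸ h⟩
      · obtain ⟨h1, h2⟩ := hy.inf_covBy_of_ne hz hne
        obtain ⟨m, l, rfl, hp⟩ := ih h h1 (le_inf h.le he)
        exact ⟨_, _, rfl, .cons h2 hp⟩

theorem CPeq.of_inf {x y z : L} (hy : y ⋖ x) (hz : z ⋖ x) (hne : y ≠ z) :
    CPeq t (x, y) (z, y ⊓ z) :=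
  have h := hy.inf_covBy_of_ne hz hne
  .rel _ _ (Or.inr ⟨hy, h.2, hz, h.1⟩)

theorem CPeq.congr_left {a b : L × L} (h : CPeq t a b) : CPeq t a p ↔ CPeq t b p :=
  ⟨fun h' => .trans _ _ _ (.symm _ _ h) h', fun h' => .trans _ _ _ h h'⟩

/-- The number of covering pairs of a given class along a covering chain depends only on the
endpoints of the chain. -/
theorem CovPath.count_unique {e : L} {n : ℕ} : ∀ {x : L} {k m l : ℕ},
    CovPath t p e x n k → CovPath t p e x m l → k = l := by
  induction n with
  | zero =>
    rintro x k m l h h'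
    cases h
    cases h' with
    | nil => rfl
    | cons hy h' => exact absurd hy.lt h'.le.not_gt
  | succ n ih =>
    rintro x k m l h h'
    cases h with
    | @cons _ y _ k hy h =>
      cases h' with
      | nil => exact absurd hy.lt h.le.not_gt
      | @cons _ z m l hz h' =>
        by_cases hne : y = z
        · subst hne
          rw [ih h h']
        · obtain ⟨h1, h2⟩ := hy.inf_covBy_of_ne hz hne
          obtain ⟨d, c, rfl, hp⟩ := h.exists_of_covBy h1 (le_inf h.le h'.le)
          have e1 := ih h (.cons h1 hp)
          have e2 := ih (.cons h2 hp) h'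
          have c1 := (CPeq.of_inf (t := t) hy hz hne).congr_left (p := p)
          have c2 := (CPeq.of_inf (t := t) hz hy (Ne.symm hne)).congr_left (p := p)
          rw [inf_comm] at c2
          rw [e1, ← e2]
          rw [propext c1, propext c2]
          omega

open scoped Classical in
theorem phi_covBy [OrderTop L] {a b : L} (hab : b ⋖ a)
    (ha : Relation.ReflTransGen (fun a b => b ⋖ a) (⊤ : L) a) :
    phi t b p = phi t a p + if CPeq t (a, b) p then 1 else 0 := by
  obtain ⟨n, h⟩ := covPath_phi (t := t) (p := p) ha
  obtain ⟨m, h'⟩ := covPath_phi (t := t) (p := p) (ha.tail hab)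
  exact h'.count_unique (h.snoc hab)

theorem reflTransGen_of_mem_tauP [OrderTop L] (hc0 : CondC0 t) (hc1 : CondC1 t)
    (hc2 : CondC2 t) : ∀ x ∈ TauP t, Relation.ReflTransGen (fun a b => b ⋖ a) (⊤ : L) x := by
  by_contra! hex
  let S : Set L := {x | x ∈ TauP t ∧ ¬ Relation.ReflTransGen (fun a b => b ⋖ a) (⊤ : L) x}
  have hS : S.Finite := hc0.2.subset fun x hx => hx.1
  obtain ⟨x, ⟨hxP, hx⟩, hmax⟩ := hS.exists_maximal hex
  have hIoi : Set.Ioi x ⊆ TauP t := by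
    intro y hy
    obtain ⟨⟨r, q⟩, ⟨hq, rfl⟩, -⟩ := hc1 y
    rcases Nat.eq_zero_or_pos r with rfl | hr
    · exact hq
    · exact absurd hy (hc2 x hxP q hq r hr)
  have hne : x ≠ ⊤ := fun h => hx (h ▸ .refl)
  obtain ⟨y, hy, hmin⟩ := (hc0.2.subset hIoi).exists_minimal ⟨⊤, hne.lt_top⟩
  have hcov : x ⋖ y := ⟨hy, fun z hxz hzy => hzy.not_ge (hmin hxz hzy.le)⟩
  have hyr : Relation.ReflTransGen (fun a b => b ⋖ a) (⊤ : L) y := by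
    by_contra h
    exact hcov.lt.not_ge (hmax ⟨hIoi hy, h⟩ hcov.le)
  exact hx (hyr.tail hcov)

/-- Every element of `L` is the end of a covering chain starting at `⊤`. -/
theorem reflTransGen_top [OrderTop L] (ht : TauMap t) (hc0 : CondC0 t) (hc1 : CondC1 t)
    (hc2 : CondC2 t) (hc4 : CondC4 t) (x : L) :
    Relation.ReflTransGen (fun a b => b ⋖ a) (⊤ : L) x := by
  have htop : Relation.ReflTransGen (fun a b => b ⋖ a) (⊤ : L) (t ⊤) := by
    by_cases h : (⊤ : L) ∈ TauP t
    · obtain ⟨r, w, h0, hr, hw, -⟩ := hc4 ⊤ h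
      simpa only [h0, hr] using hw.reflTransGen
    · obtain ⟨y, hy⟩ := not_not.mp h
      have h' : t ⊤ = ⊤ := top_le_iff.mp (hy.ge.trans ((ht.le_iff y ⊤).mp le_top))
      rw [h']
  obtain ⟨⟨r, q⟩, ⟨hq, rfl⟩, -⟩ := hc1 x
  induction r with
  | zero => exact reflTransGen_of_mem_tauP hc0 hc1 hc2 q hq
  | succ r ih =>
    rw [Function.iterate_succ_apply']
    exact htop.trans ((ih hq).lift t fun a b h => ht.cov b a h)

end Distrib

/-- If `(L, τ⁻¹)` satisfies (c0)–(c4), then the relation on `Λ` defined by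
`λ₁ ≤ λ₂` iff `φ(x)_{λ₁} ≥ φ(x)_{λ₂}` for all `x ∈ L` is a partial order on `Λ`
(reflexive, transitive, and — the essential point — antisymmetric: on representatives,
mutually comparable covering pairs are `∼`-equivalent). -/
theorem stmt14 {L : Type*} [DistribLattice L] [OrderTop L] [Infinite L] (t : L → L)
    (ht : TauMap t) (hc0 : CondC0 t) (hc1 : CondC1 t) (hc2 : CondC2 t) (hc3 : CondC3 t)
    (hc4 : CondC4 t) :
    (∀ p : L × L, p.2 ⋖ p.1 → ∀ x : L, phi t x p ≤ phi t x p) ∧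
    (∀ p q s : L × L, p.2 ⋖ p.1 → q.2 ⋖ q.1 → s.2 ⋖ s.1 →
      (∀ x : L, phi t x q ≤ phi t x p) → (∀ x : L, phi t x s ≤ phi t x q) →
      (∀ x : L, phi t x s ≤ phi t x p)) ∧
    (∀ p q : L × L, p.2 ⋖ p.1 → q.2 ⋖ q.1 →
      (∀ x : L, phi t x q ≤ phi t x p) → (∀ x : L, phi t x p ≤ phi t x q) →
      CPeq t p q) := by
  classical
  refine ⟨fun _ _ _ => le_rfl, fun _ _ _ _ _ _ h h' x => (h' x).trans (h x), ?_⟩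
  intro p q hp _ h h'
  have hphi : ∀ x, phi t x p = phi t x q := fun x => (h' x).antisymm (h x)
  have htop := reflTransGen_top ht hc0 hc1 hc2 hc4 p.1
  have e1 := phi_covBy (t := t) (p := p) hp htop
  have e2 := phi_covBy (t := t) (p := q) hp htop
  rw [if_pos (.refl p), hphi, hphi, e2] at e1
  by_contra hne
  rw [if_neg hne] at e1
  omega
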